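/- arXiv:1401.0843 — 3 statements merged into one kernel-verified Lean document; each statement's English description precedes it below -/
import Mathlib

section
/- Under Assumption 1, the following three policy-evaluation estimators coincide: the instrumental variables Bellman error minimization estimator θ̂_IV = [Φ₀ᵀ (Φ₀ − γΦ₁)]⁻¹ Φ₀ᵀ C, the least-squares projected Bellman error minimization estimator θ̂_LSP = [(Π(Φ₀ − γΦ₁))ᵀ (Π(Φ₀ − γΦ₁))]⁻¹ (Π(Φ₀ − γΦ₁))ᵀ Π C, and the instrumental variables projected Bellman error minimization estimator θ̂_IVP = [Φ₀ᵀ Π (Φ₀ − γΦ₁)]⁻¹ Φ₀ᵀ Π C; that is, θ̂_IV = θ̂_LSP = θ̂_IVP. -/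
open Matrix

/-- Under Assumption 1, the instrumental variables Bellman error minimization
estimator, the least-squares projected Bellman error minimization estimator,
and the instrumental variables projected Bellman error minimization estimator
all coincide. -/
theorem stmt_0 (n k : ℕ) (hn : 0 < n) (hk : 0 < k) (hkn : k ≤ n) (γ : ℝ)
    (Φ₀ Φ₁ : Matrix (Fin n) (Fin k) ℝ) (C : Fin n → ℝ)
    (Pr : Matrix (Fin n) (Fin n) ℝ)
    (hPr : Pr = Φ₀ * (Φ₀ᵀ * Φ₀)⁻¹ * Φ₀ᵀ)
    (hGram : IsUnit (Φ₀ᵀ * Φ₀))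
    (hIV : IsUnit (Φ₀ᵀ * (Φ₀ - γ • Φ₁)))
    (hLSP : IsUnit ((Pr * (Φ₀ - γ • Φ₁))ᵀ * (Pr * (Φ₀ - γ • Φ₁)))) :
    (Φ₀ᵀ * (Φ₀ - γ • Φ₁))⁻¹ *ᵥ (Φ₀ᵀ *ᵥ C)
      = ((Pr * (Φ₀ - γ • Φ₁))ᵀ * (Pr * (Φ₀ - γ • Φ₁)))⁻¹
          *ᵥ ((Pr * (Φ₀ - γ • Φ₁))ᵀ *ᵥ (Pr *ᵥ C))
    ∧ ((Pr * (Φ₀ - γ • Φ₁))ᵀ * (Pr * (Φ₀ - γ • Φ₁)))⁻¹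
          *ᵥ ((Pr * (Φ₀ - γ • Φ₁))ᵀ *ᵥ (Pr *ᵥ C))
      = (Φ₀ᵀ * Pr * (Φ₀ - γ • Φ₁))⁻¹ *ᵥ (Φ₀ᵀ *ᵥ (Pr *ᵥ C)) := by
  set B := Φ₀ - γ • Φ₁
  have hΦPr : Φ₀ᵀ * Pr = Φ₀ᵀ := by
    rw [hPr, ← Matrix.mul_assoc, ← Matrix.mul_assoc,
      Matrix.mul_nonsing_inv _ ((Matrix.isUnit_iff_isUnit_det _).mp hGram), Matrix.one_mul]
  set θ := (Φ₀ᵀ * B)⁻¹ *ᵥ (Φ₀ᵀ *ᵥ C) with hθ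
  have hNormal : Φ₀ᵀ *ᵥ (B *ᵥ θ) = Φ₀ᵀ *ᵥ C := by
    rw [hθ, mulVec_mulVec, mulVec_mulVec,
      Matrix.mul_nonsing_inv _ ((Matrix.isUnit_iff_isUnit_det _).mp hIV), one_mulVec]
  have hProj : Pr *ᵥ C = (Pr * B) *ᵥ θ := by
    rw [← mulVec_mulVec, hPr, ← mulVec_mulVec C, ← mulVec_mulVec (B *ᵥ θ), hNormal]
  have hLS : ((Pr * B)ᵀ * (Pr * B))⁻¹ *ᵥ ((Pr * B)ᵀ *ᵥ (Pr *ᵥ C)) = θ := by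
    rw [hProj, mulVec_mulVec _ (Pr * B)ᵀ, mulVec_mulVec,
      Matrix.nonsing_inv_mul _ ((Matrix.isUnit_iff_isUnit_det _).mp hLSP), one_mulVec]
  refine ⟨hLS.symm, ?_⟩
  rw [hLS, mulVec_mulVec C, hΦPr]
end

section
/- The instrumental variables projected Bellman error minimization estimator equals the instrumental variables Bellman error minimization estimator: [Φ₀ᵀ Π (Φ₀ − γΦ₁)]⁻¹ Φ₀ᵀ Π C = [Φ₀ᵀ (Φ₀ − γΦ₁)]⁻¹ Φ₀ᵀ C. -/
open Matrix

/-- The instrumental variables projected Bellman error minimization estimator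
equals the instrumental variables Bellman error minimization estimator. -/
theorem stmt_1 (n k : ℕ) (hn : 0 < n) (hk : 0 < k) (hkn : k ≤ n) (γ : ℝ)
    (Φ₀ Φ₁ : Matrix (Fin n) (Fin k) ℝ) (C : Fin n → ℝ)
    (Pr : Matrix (Fin n) (Fin n) ℝ)
    (hPr : Pr = Φ₀ * (Φ₀ᵀ * Φ₀)⁻¹ * Φ₀ᵀ)
    (hGram : IsUnit (Φ₀ᵀ * Φ₀))
    (hIV : IsUnit (Φ₀ᵀ * (Φ₀ - γ • Φ₁))) :
    (Φ₀ᵀ * Pr * (Φ₀ - γ • Φ₁))⁻¹ *ᵥ (Φ₀ᵀ *ᵥ (Pr *ᵥ C))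
      = (Φ₀ᵀ * (Φ₀ - γ • Φ₁))⁻¹ *ᵥ (Φ₀ᵀ *ᵥ C) := by
  have h : Φ₀ᵀ * Pr = Φ₀ᵀ := by
    rw [hPr, ← Matrix.mul_assoc, ← Matrix.mul_assoc,
      Matrix.mul_nonsing_inv _ ((Matrix.isUnit_iff_isUnit_det _).mp hGram), Matrix.one_mul]
  rw [Matrix.mulVec_mulVec C Φ₀ᵀ Pr, h]
end

section
/- The least-squares projected Bellman error minimization estimator equals the instrumental variables Bellman error minimization estimator: [(Π(Φ₀ − γΦ₁))ᵀ (Π(Φ₀ − γΦ₁))]⁻¹ (Π(Φ₀ − γΦ₁))ᵀ Π C = [Φ₀ᵀ (Φ₀ − γΦ₁)]⁻¹ Φ₀ᵀ C. -/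
open Matrix

/-- The least-squares projected Bellman error minimization estimator equals the
instrumental variables Bellman error minimization estimator. -/
theorem stmt_2 (n k : ℕ) (hn : 0 < n) (hk : 0 < k) (hkn : k ≤ n) (γ : ℝ)
    (Φ₀ Φ₁ : Matrix (Fin n) (Fin k) ℝ) (C : Fin n → ℝ)
    (Pr : Matrix (Fin n) (Fin n) ℝ)
    (hPr : Pr = Φ₀ * (Φ₀ᵀ * Φ₀)⁻¹ * Φ₀ᵀ)
    (hGram : IsUnit (Φ₀ᵀ * Φ₀))
    (hIV : IsUnit (Φ₀ᵀ * (Φ₀ - γ • Φ₁)))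
    (hLSP : IsUnit ((Pr * (Φ₀ - γ • Φ₁))ᵀ * (Pr * (Φ₀ - γ • Φ₁)))) :
    ((Pr * (Φ₀ - γ • Φ₁))ᵀ * (Pr * (Φ₀ - γ • Φ₁)))⁻¹
        *ᵥ ((Pr * (Φ₀ - γ • Φ₁))ᵀ *ᵥ (Pr *ᵥ C))
      = (Φ₀ᵀ * (Φ₀ - γ • Φ₁))⁻¹ *ᵥ (Φ₀ᵀ *ᵥ C) := by
  set D := Φ₀ - γ • Φ₁
  have hPrC : Pr *ᵥ C = (Pr * D) *ᵥ ((Φ₀ᵀ * D)⁻¹ *ᵥ (Φ₀ᵀ *ᵥ C)) := by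
    have hPrD : Pr * D = Φ₀ * (Φ₀ᵀ * Φ₀)⁻¹ * (Φ₀ᵀ * D) := by
      rw [hPr, Matrix.mul_assoc _ Φ₀ᵀ D]
    rw [hPrD, mulVec_mulVec, mul_nonsing_inv_cancel_right _ _ ((isUnit_iff_isUnit_det _).mp hIV),
      mulVec_mulVec, hPr]
  rw [hPrC, mulVec_mulVec, mulVec_mulVec, Matrix.mul_assoc,
    nonsing_inv_mul _ ((isUnit_iff_isUnit_det _).mp hLSP), one_mulVec]
end
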